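/- There exist absolute constants ε₀ ∈ (0,1) and C > 0 such that if 0 < ε ≤ ε₀, then there exist bounded, even, twice continuously differentiable functions h₁, h₂ : ℝ → ℝ satisfying −h₁″ + h₁ + a⁺·h₁ = 2λ·h₂ and −h₂″ + h₂ + a⁻·h₂ = 2λ·h₁ on ℝ, together with the bounds |h₁(y) + cos(τ·y)| ≤ C·ε and |h₂(y) + cos(τ·y)| ≤ C·ε for all y ∈ ℝ (in particular h₁ and h₂ are non-trivial). -/

import Mathlib

open MeasureTheory

lemma integral_exp_mul_abs {a : ℝ} (ha : a < 0) : ∫ s : ℝ, Real.exp (a * |s|) = -2 / a := by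
  rw [integral_comp_abs (f := fun s => Real.exp (a * s)), integral_exp_mul_Ioi ha]
  simp
  ring

lemma integrable_exp_mul_abs_real {a : ℝ} (ha : a < 0) :
    Integrable fun s : ℝ => Real.exp (a * |s|) := by
  refine Integrable.of_integral_ne_zero ?_
  rw [integral_exp_mul_abs ha]
  exact div_ne_zero (by norm_num) ha.ne

lemma integrable_cexp_mul_of_abs_le {f : ℝ → ℝ} {c : ℝ} (hf : Continuous f)
    (hfc : ∀ s, |f s| ≤ c * Real.exp (-2 * |s|)) {z : ℂ} (hz : |z.re| < 2) :
    Integrable fun s : ℝ => Complex.exp (z * s) * f s := by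
  refine ((integrable_exp_mul_abs_real (a := |z.re| - 2) (by linarith)).const_mul c).mono'
    (by fun_prop) (ae_of_all _ fun s => ?_)
  have hc : 0 ≤ c := by simpa using (abs_nonneg _).trans (hfc 0)
  have hre : (z * s).re ≤ |z.re| * |s| := by
    simpa [abs_mul] using le_abs_self (z.re * s)
  calc ‖Complex.exp (z * s) * f s‖ = Real.exp (z * s).re * |f s| := by
        simp [Complex.norm_exp]
    _ ≤ Real.exp (|z.re| * |s|) * (c * Real.exp (-2 * |s|)) := by
        gcongr
        exact hfc s
    _ = c * Real.exp ((|z.re| - 2) * |s|) := by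
        rw [mul_left_comm, ← Real.exp_add]
        ring_nf

lemma hasDerivAt_integral_Iic {F : ℝ → ℂ} (hc : Continuous F) (hi : Integrable F) (y : ℝ) :
    HasDerivAt (fun y => ∫ s in Set.Iic y, F s) (F y) y := by
  have h : (fun y => ∫ s in Set.Iic y, F s) =
      fun y => (∫ s in (0 : ℝ)..y, F s) + ∫ s in Set.Iic (0 : ℝ), F s := by
    funext y
    rw [← intervalIntegral.integral_Iic_sub_Iic hi.integrableOn hi.integrableOn, sub_add_cancel]
  rw [h]
  exact (hc.integral_hasStrictDerivAt 0 y).hasDerivAt.add_const _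

lemma hasDerivAt_integral_Ioi {F : ℝ → ℂ} (hc : Continuous F) (hi : Integrable F) (y : ℝ) :
    HasDerivAt (fun y => ∫ s in Set.Ioi y, F s) (-F y) y := by
  have h : (fun y => ∫ s in Set.Ioi y, F s) =
      fun y => (∫ s, F s) - ∫ s in Set.Iic y, F s := by
    funext y
    rw [← intervalIntegral.integral_Iic_add_Ioi hi.integrableOn hi.integrableOn, add_sub_cancel_left]
  rw [h]
  exact (hasDerivAt_integral_Iic hc hi y).const_sub _

/-- A fundamental solution of `w'' = μ ^ 2 * w` on the line, when `μ ^ 2` is real. -/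
noncomputable def greenKernel (μ : ℂ) (t : ℝ) : ℝ := (-Complex.exp (-μ * |t|) / (2 * μ)).re

lemma continuous_greenKernel (μ : ℂ) : Continuous (greenKernel μ) := by
  unfold greenKernel
  fun_prop

lemma greenKernel_neg (μ : ℂ) (t : ℝ) : greenKernel μ (-t) = greenKernel μ t := by
  simp [greenKernel]

lemma abs_greenKernel_le_one {μ : ℂ} (hre : 0 ≤ μ.re) (hμ : 1 / 2 ≤ ‖μ‖) (t : ℝ) :
    |greenKernel μ t| ≤ 1 := by
  refine (Complex.abs_re_le_norm _).trans ?_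
  have h : ‖Complex.exp (-μ * |t|)‖ ≤ 1 := by
    rw [Complex.norm_exp, Real.exp_le_one_iff]
    simpa using mul_nonneg hre (abs_nonneg t)
  rw [norm_div, norm_neg, norm_mul, Complex.norm_ofNat]
  exact div_le_one_of_le₀ (by linarith) (by positivity)

lemma exists_hasDerivAt_integral_greenKernel {f : ℝ → ℝ} {c : ℝ} (hf : Continuous f)
    (hfc : ∀ s, |f s| ≤ c * Real.exp (-2 * |s|)) {μ : ℂ} (hμ : |μ.re| < 2) (hμ0 : μ ≠ 0)
    {m : ℝ} (hm : μ ^ 2 = m) :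
    ∃ w' : ℝ → ℝ, ∀ y, HasDerivAt (fun y => ∫ s, greenKernel μ (y - s) * f s) (w' y) y ∧
      HasDerivAt w' (m * (∫ s, greenKernel μ (y - s) * f s) + f y) y := by
  have hip := integrable_cexp_mul_of_abs_le hf hfc hμ
  have hin := integrable_cexp_mul_of_abs_le hf hfc (z := -μ) (by simpa using hμ)
  set P : ℝ → ℂ := fun y => ∫ s in Set.Iic y, Complex.exp (μ * s) * f s
  set Q : ℝ → ℂ := fun y => ∫ s in Set.Ioi y, Complex.exp (-μ * s) * f s
  have hP : ∀ y : ℝ, HasDerivAt P (Complex.exp (μ * y) * f y) y :=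
    hasDerivAt_integral_Iic (by fun_prop) hip
  have hQ : ∀ y : ℝ, HasDerivAt Q (-(Complex.exp (-μ * y) * f y)) y :=
    hasDerivAt_integral_Ioi (by fun_prop) hin
  have he : ∀ (z : ℂ) (y : ℝ), HasDerivAt (fun y : ℝ => Complex.exp (z * y))
      (Complex.exp (z * y) * z) y := fun z y => by
    simpa using ((hasDerivAt_id y).ofReal_comp.const_mul z).cexp
  have hee : ∀ y : ℝ, Complex.exp (-μ * y) * Complex.exp (μ * y) = 1 := fun y => by
    rw [← Complex.exp_add]
    simp
  have hw : ∀ y, ∫ s, greenKernel μ (y - s) * f s =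
      (-(Complex.exp (-μ * y) * P y + Complex.exp (μ * y) * Q y) / (2 * μ)).re := fun y => by
    set G : ℝ → ℂ := fun s => -Complex.exp (-μ * |y - s|) / (2 * μ) * f s
    have hGl : Set.EqOn (fun s : ℝ => -Complex.exp (-μ * y) / (2 * μ) * (Complex.exp (μ * s) * f s)) G
        (Set.Iic y) := fun s hs => by
      have : |y - s| = y - s := abs_of_nonneg (sub_nonneg.2 hs)
      simp only [G, this]
      have : Complex.exp (-μ * ↑(y - s)) = Complex.exp (-μ * y) * Complex.exp (μ * s) := by
        rw [← Complex.exp_add]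
        push_cast
        ring_nf
      rw [this]
      ring
    have hGr : Set.EqOn (fun s : ℝ => -Complex.exp (μ * y) / (2 * μ) * (Complex.exp (-μ * s) * f s)) G
        (Set.Ioi y) := fun s hs => by
      have : |y - s| = s - y := by rw [abs_sub_comm]; exact abs_of_nonneg (sub_nonneg.2 hs.le)
      simp only [G, this]
      have : Complex.exp (-μ * ↑(s - y)) = Complex.exp (μ * y) * Complex.exp (-μ * s) := by
        rw [← Complex.exp_add]
        push_cast
        ring_nf
      rw [this]
      ring
    have hIl : IntegrableOn G (Set.Iic y) :=
      (integrableOn_congr_fun hGl measurableSet_Iic).1 (hip.const_mul _).integrableOn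
    have hIr : IntegrableOn G (Set.Ioi y) :=
      (integrableOn_congr_fun hGr measurableSet_Ioi).1 (hin.const_mul _).integrableOn
    have hI : Integrable G := by
      rw [← integrableOn_univ, ← Set.Iic_union_Ioi (a := y)]
      exact hIl.union hIr
    have hG : ∫ s, G s = -(Complex.exp (-μ * y) * P y + Complex.exp (μ * y) * Q y) / (2 * μ) := by
      rw [← intervalIntegral.integral_Iic_add_Ioi hIl hIr,
        ← setIntegral_congr_fun measurableSet_Iic hGl, ← setIntegral_congr_fun measurableSet_Ioi hGr,
        integral_const_mul, integral_const_mul]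
      ring
    rw [← hG]
    refine Eq.trans ?_ (integral_re hI)
    simp [G, greenKernel]
  simp_rw [hw]
  refine ⟨fun y => ((Complex.exp (-μ * y) * P y - Complex.exp (μ * y) * Q y) / 2).re,
    fun y => ⟨?_, ?_⟩⟩
  · have h := Complex.reCLM.hasFDerivAt.comp_hasDerivAt y
      ((((he (-μ) y).mul (hP y)).add ((he μ y).mul (hQ y))).neg.div_const (2 * μ))
    refine h.congr_deriv (congrArg Complex.re ?_)
    field_simp
    ring
  · have h := Complex.reCLM.hasFDerivAt.comp_hasDerivAt y
      ((((he (-μ) y).mul (hP y)).sub ((he μ y).mul (hQ y))).div_const 2)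
    refine h.congr_deriv ?_
    rw [← Complex.re_ofReal_mul, ← hm, ← Complex.ofReal_re (f y), ← Complex.add_re,
      Complex.ofReal_re]
    refine congrArg Complex.re ?_
    simp only [neg_mul] at hee ⊢
    field_simp
    linear_combination (2 * (f y : ℂ)) * hee y

/-- A contractive integral equation on the line which is invariant under reflection has a bounded
even solution. -/
lemma exists_even_solution_integral_equation {E : Type*} [NormedAddCommGroup E] [NormedSpace ℝ E]
    [CompleteSpace E] {F : ℝ → ℝ → E → E} {b : ℝ → ℝ} {c : ℝ → E} {M : ℝ}
    (hF : Continuous fun p : ℝ × ℝ × E => F p.1 p.2.1 p.2.2) (hF0 : ∀ y s, F y s 0 = 0)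
    (hFL : ∀ y s x x', ‖F y s x - F y s x'‖ ≤ b s * ‖x - x'‖)
    (hFe : ∀ y s x, F (-y) (-s) x = F y s x)
    (hb : Integrable b) (hb0 : ∀ s, 0 ≤ b s) (hb1 : ∫ s, b s ≤ 1 / 2)
    (hc : Continuous c) (hcM : ∀ y, ‖c y‖ ≤ M) (hce : ∀ y, c (-y) = c y) :
    ∃ h : ℝ → E, Continuous h ∧ (∀ y, ‖h y‖ ≤ 2 * M) ∧ (∀ y, h (-y) = h y) ∧
      ∀ y, h y = c y + ∫ s, F y s (h s) := by
  have hFn : ∀ y s x, ‖F y s x‖ ≤ b s * ‖x‖ := fun y s x => by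
    simpa [hF0] using hFL y s x 0
  have hcont : ∀ (h : BoundedContinuousFunction ℝ E) (y : ℝ), Continuous fun s => F y s (h s) :=
    fun h y => hF.comp (by fun_prop : Continuous fun s => (y, s, h s))
  have hbd : ∀ (h : BoundedContinuousFunction ℝ E) y s, ‖F y s (h s)‖ ≤ b s * ‖h‖ := fun h y s =>
    (hFn y s _).trans (mul_le_mul_of_nonneg_left (h.norm_coe_le_norm s) (hb0 s))
  have hint : ∀ (h : BoundedContinuousFunction ℝ E) y, Integrable fun s => F y s (h s) :=
    fun h y => (hb.mul_const ‖h‖).mono' (hcont h y).aestronglyMeasurable (ae_of_all _ (hbd h y))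
  have hbound : ∀ (h : BoundedContinuousFunction ℝ E) y,
      ‖∫ s, F y s (h s)‖ ≤ 1 / 2 * ‖h‖ := fun h y => by
    refine (norm_integral_le_of_norm_le (hb.mul_const ‖h‖) (ae_of_all _ (hbd h y))).trans ?_
    rw [integral_mul_const]
    gcongr
  have hIc : ∀ h : BoundedContinuousFunction ℝ E, Continuous fun y => ∫ s, F y s (h s) := fun h =>
    continuous_of_dominated (fun y => (hcont h y).aestronglyMeasurable)
      (fun y => ae_of_all _ (hbd h y)) (hb.mul_const ‖h‖)
      (ae_of_all _ fun s => hF.comp (by fun_prop : Continuous fun y => (y, s, h s)))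
  let Φ : BoundedContinuousFunction ℝ E → BoundedContinuousFunction ℝ E := fun h =>
    .ofNormedAddCommGroup (fun y => c y + ∫ s, F y s (h s)) (hc.add (hIc h)) (M + 1 / 2 * ‖h‖)
      fun y => (norm_add_le _ _).trans (add_le_add (hcM y) (hbound h y))
  have hΦ : ContractingWith (1 / 2) Φ := by
    refine ⟨by rw [div_lt_one] <;> norm_num, LipschitzWith.of_dist_le_mul fun h g => ?_⟩
    refine (BoundedContinuousFunction.dist_le (by positivity)).2 fun y => ?_
    have hbd' : ∀ s, ‖F y s (h s) - F y s (g s)‖ ≤ b s * dist h g := fun s =>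
      (hFL y s _ _).trans (mul_le_mul_of_nonneg_left
        (by rw [← dist_eq_norm]; exact BoundedContinuousFunction.dist_coe_le_dist s) (hb0 s))
    change dist (c y + ∫ s, F y s (h s)) (c y + ∫ s, F y s (g s)) ≤ _
    rw [dist_add_left, dist_eq_norm, ← integral_sub (hint h y) (hint g y)]
    refine (norm_integral_le_of_norm_le (hb.mul_const _) (ae_of_all _ hbd')).trans ?_
    rw [integral_mul_const]
    push_cast
    gcongr
  obtain ⟨h, hh⟩ : ∃ h, Φ h = h := ⟨_, hΦ.fixedPoint_isFixedPt⟩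
  have hfix : ∀ y, h y = c y + ∫ s, F y s (h s) := fun y => (DFunLike.congr_fun hh y).symm
  let r : BoundedContinuousFunction ℝ E := h.compContinuous ⟨Neg.neg, continuous_neg⟩
  have hr : Φ r = r := by
    ext y
    change c y + ∫ s, F y s (h (-s)) = h (-y)
    rw [hfix, hce, ← integral_neg_eq_self]
    simp [← hFe y]
  have hn : ‖h‖ ≤ M + 1 / 2 * ‖h‖ := by
    refine (BoundedContinuousFunction.norm_le ?_).2 fun y => ?_
    · have := (norm_nonneg _).trans (hcM 0)
      positivity
    · rw [hfix]
      exact (norm_add_le _ _).trans (add_le_add (hcM y) (hbound h y))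
  refine ⟨h, h.continuous, fun y => (h.norm_coe_le_norm y).trans (by linarith), fun y => ?_, hfix⟩
  exact DFunLike.congr_fun (hΦ.fixedPoint_unique' hr hh) y

lemma contDiff_two_and_deriv_deriv_eq {h h' h'' : ℝ → ℝ} (hh : ∀ y, HasDerivAt h (h' y) y)
    (hh' : ∀ y, HasDerivAt h' (h'' y) y) (hc : Continuous h'') :
    ContDiff ℝ 2 h ∧ ∀ y, deriv (deriv h) y = h'' y := by
  have h1 : deriv h = h' := funext fun y => (hh y).deriv
  have h2 : deriv h' = h'' := funext fun y => (hh' y).deriv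
  refine ⟨?_, fun y => by rw [h1, h2]⟩
  rw [show (2 : WithTop ℕ∞) = 1 + 1 by norm_num, contDiff_succ_iff_deriv, h1]
  refine ⟨fun y => (hh y).differentiableAt, by simp, contDiff_one_iff_deriv.2 ⟨?_, h2 ▸ hc⟩⟩
  exact fun y => (hh' y).differentiableAt

lemma abs_mul_le_of_abs_le_one {k : ℝ → ℝ} (hk : ∀ t, |k t| ≤ 1) {f : ℝ → ℝ} {c : ℝ}
    (hfc : ∀ s, |f s| ≤ c * Real.exp (-2 * |s|)) (y s : ℝ) :
    ‖k (y - s) * f s‖ ≤ c * Real.exp (-2 * |s|) := by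
  rw [norm_mul]
  exact (mul_le_of_le_one_left (norm_nonneg _) (hk _)).trans (hfc s)

lemma integrable_kernel_mul {k : ℝ → ℝ} (hkc : Continuous k) (hk : ∀ t, |k t| ≤ 1) {f : ℝ → ℝ}
    {c : ℝ} (hf : Continuous f) (hfc : ∀ s, |f s| ≤ c * Real.exp (-2 * |s|)) (y : ℝ) :
    Integrable fun s => k (y - s) * f s :=
  ((integrable_exp_mul_abs_real (by norm_num)).const_mul c).mono' (by fun_prop)
    (ae_of_all _ (abs_mul_le_of_abs_le_one hk hfc y))

lemma abs_integral_kernel_mul_le {k : ℝ → ℝ} (hk : ∀ t, |k t| ≤ 1) {f : ℝ → ℝ} {c : ℝ}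
    (hfc : ∀ s, |f s| ≤ c * Real.exp (-2 * |s|)) (y : ℝ) :
    |∫ s, k (y - s) * f s| ≤ c := by
  refine (norm_integral_le_of_norm_le ((integrable_exp_mul_abs_real (by norm_num)).const_mul c)
    (ae_of_all _ (abs_mul_le_of_abs_le_one hk hfc y))).trans ?_
  rw [integral_const_mul, integral_exp_mul_abs (by norm_num)]
  norm_num

/-- The coupled integral equations behind the system: `p` and `q` are the sum and difference parts
of the perturbation. -/
lemma exists_even_solution_coupled_integral_equations {ap am k₁ k₂ c : ℝ → ℝ} {ε : ℝ}
    (hap : Continuous ap) (ham : Continuous am) (hape : ∀ y, ap (-y) = ap y)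
    (hame : ∀ y, am (-y) = am y) (hapb : ∀ y, |ap y| ≤ ε * Real.exp (-2 * |y|))
    (hamb : ∀ y, |am y| ≤ ε * Real.exp (-2 * |y|)) (hε0 : 0 ≤ ε) (hε : ε ≤ 1 / 4)
    (hk₁c : Continuous k₁) (hk₂c : Continuous k₂) (hk₁ : ∀ t, |k₁ t| ≤ 1) (hk₂ : ∀ t, |k₂ t| ≤ 1)
    (hk₁e : ∀ t, k₁ (-t) = k₁ t) (hk₂e : ∀ t, k₂ (-t) = k₂ t)
    (hc : Continuous c) (hcb : ∀ y, |c y| ≤ 1) (hce : ∀ y, c (-y) = c y) :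
    ∃ h₁ h₂ p q : ℝ → ℝ, Continuous h₁ ∧ Continuous h₂ ∧ Continuous p ∧ Continuous q ∧
      (∀ y, h₁ (-y) = h₁ y) ∧ (∀ y, h₂ (-y) = h₂ y) ∧
      (∀ y, p y + q y = ap y * h₁ y) ∧ (∀ y, p y - q y = am y * h₂ y) ∧
      (∀ y, |p y| ≤ 2 * ε * Real.exp (-2 * |y|)) ∧ (∀ y, |q y| ≤ 2 * ε * Real.exp (-2 * |y|)) ∧
      (∀ y, h₁ y = c y + ((∫ s, k₁ (y - s) * p s) + ∫ s, k₂ (y - s) * q s)) ∧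
      (∀ y, h₂ y = c y + ((∫ s, k₁ (y - s) * p s) - ∫ s, k₂ (y - s) * q s)) := by
  have hpq : ∀ (s : ℝ) (x : ℝ × ℝ), |(ap s * x.1 + am s * x.2) / 2| ≤
      ε * Real.exp (-2 * |s|) * ‖x‖ ∧ |(ap s * x.1 - am s * x.2) / 2| ≤
      ε * Real.exp (-2 * |s|) * ‖x‖ := fun s x => by
    have h1 : |ap s * x.1| ≤ ε * Real.exp (-2 * |s|) * ‖x‖ := by
      rw [abs_mul]
      gcongr
      exacts [hapb s, norm_fst_le x]
    have h2 : |am s * x.2| ≤ ε * Real.exp (-2 * |s|) * ‖x‖ := by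
      rw [abs_mul]
      gcongr
      exacts [hamb s, norm_snd_le x]
    rw [abs_le] at h1 h2
    constructor <;> rw [abs_le] <;> constructor <;> linarith
  let F : ℝ → ℝ → ℝ × ℝ → ℝ × ℝ := fun y s x =>
    (k₁ (y - s) * ((ap s * x.1 + am s * x.2) / 2) + k₂ (y - s) * ((ap s * x.1 - am s * x.2) / 2),
      k₁ (y - s) * ((ap s * x.1 + am s * x.2) / 2) - k₂ (y - s) * ((ap s * x.1 - am s * x.2) / 2))
  have hFn : ∀ y s x, ‖F y s x‖ ≤ 2 * ε * Real.exp (-2 * |s|) * ‖x‖ := fun y s x => by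
    have h1 := (abs_mul _ _).trans_le
      ((mul_le_of_le_one_left (abs_nonneg _) (hk₁ (y - s))).trans (hpq s x).1)
    have h2 := (abs_mul _ _).trans_le
      ((mul_le_of_le_one_left (abs_nonneg _) (hk₂ (y - s))).trans (hpq s x).2)
    rw [Prod.norm_def]
    refine max_le ((abs_add_le _ _).trans ?_) ((abs_sub _ _).trans ?_) <;> linarith
  have hb : Integrable fun s : ℝ => 2 * ε * Real.exp (-2 * |s|) :=
    (integrable_exp_mul_abs_real (by norm_num)).const_mul _
  obtain ⟨h, hhc, hhb, hhe, hh⟩ := exists_even_solution_integral_equation (F := F)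
    (b := fun s => 2 * ε * Real.exp (-2 * |s|)) (c := fun y => (c y, c y)) (M := 1)
    (by fun_prop) (fun y s => by simp [F])
    (fun y s x x' => by
      refine le_of_eq_of_le (congrArg norm ?_) (hFn y s (x - x'))
      ext <;> simp only [F, Prod.fst_sub, Prod.snd_sub] <;> ring)
    (fun y s x => by
      have : -y - -s = -(y - s) := by ring
      simp only [F, this, hape, hame, hk₁e, hk₂e])
    hb (fun s => by positivity)
    (by
      rw [integral_const_mul, integral_exp_mul_abs (by norm_num)]
      linarith)
    (by fun_prop) (fun y => by simpa [Prod.norm_def] using hcb y) (fun y => by rw [hce])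
  let p : ℝ → ℝ := fun s => (ap s * (h s).1 + am s * (h s).2) / 2
  let q : ℝ → ℝ := fun s => (ap s * (h s).1 - am s * (h s).2) / 2
  have hp : Continuous p := by fun_prop
  have hq : Continuous q := by fun_prop
  have hle : ∀ s, ε * Real.exp (-2 * |s|) * ‖h s‖ ≤ 2 * ε * Real.exp (-2 * |s|) := fun s => by
    nlinarith [hhb s, mul_nonneg hε0 (Real.exp_pos (-2 * |s|)).le]
  have hpb : ∀ s, |p s| ≤ 2 * ε * Real.exp (-2 * |s|) := fun s => (hpq s (h s)).1.trans (hle s)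
  have hqb : ∀ s, |q s| ≤ 2 * ε * Real.exp (-2 * |s|) := fun s => (hpq s (h s)).2.trans (hle s)
  have hip := integrable_kernel_mul hk₁c hk₁ hp hpb
  have hiq := integrable_kernel_mul hk₂c hk₂ hq hqb
  have hiF : ∀ y, Integrable fun s => F y s (h s) := fun y =>
    ((hip y).add (hiq y)).prodMk ((hip y).sub (hiq y))
  refine ⟨fun y => (h y).1, fun y => (h y).2, p, q, by fun_prop, by fun_prop, hp, hq,
    fun y => congrArg Prod.fst (hhe y), fun y => congrArg Prod.snd (hhe y), fun y => by simp only [p, q]; ring,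
    fun y => by simp only [p, q]; ring, hpb, hqb, fun y => ?_, fun y => ?_⟩
  · rw [← integral_add (hip y) (hiq y)]
    simpa only [Prod.fst_add, fst_integral (hiF y)] using congrArg Prod.fst (hh y)
  · rw [← integral_sub (hip y) (hiq y)]
    simpa only [Prod.snd_add, snd_integral (hiF y)] using congrArg Prod.snd (hh y)

theorem stmt5 :
    ∃ ε₀ ∈ Set.Ioo (0:ℝ) 1, ∃ C : ℝ, 0 < C ∧
      ∀ (ap am : ℝ → ℝ) (ε lam : ℝ),
        Continuous ap → Continuous am →
        (∀ y, ap (-y) = ap y) → (∀ y, am (-y) = am y) →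
        (∀ y, |ap y| ≤ ε * Real.exp (-2 * |y|)) →
        (∀ y, |am y| ≤ ε * Real.exp (-2 * |y|)) →
        lam ∈ Set.Icc (3/4 : ℝ) 1 →
        0 < ε → ε ≤ ε₀ →
        ∃ h₁ h₂ : ℝ → ℝ,
          (∃ M, ∀ y, |h₁ y| ≤ M) ∧ (∃ M, ∀ y, |h₂ y| ≤ M) ∧
          (∀ y, h₁ (-y) = h₁ y) ∧ (∀ y, h₂ (-y) = h₂ y) ∧
          ContDiff ℝ 2 h₁ ∧ ContDiff ℝ 2 h₂ ∧
          (∀ y, -(deriv (deriv h₁) y) + h₁ y + ap y * h₁ y = 2 * lam * h₂ y) ∧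
          (∀ y, -(deriv (deriv h₂) y) + h₂ y + am y * h₂ y = 2 * lam * h₁ y) ∧
          (∀ y, |h₁ y + Real.cos (Real.sqrt (2 * lam - 1) * y)| ≤ C * ε) ∧
          (∀ y, |h₂ y + Real.cos (Real.sqrt (2 * lam - 1) * y)| ≤ C * ε) := by
  refine ⟨1 / 4, by norm_num, 4, by norm_num, ?_⟩
  intro ap am ε lam hap ham hape hame hapb hamb hlam hε0 hε
  obtain ⟨hl, hu⟩ := hlam
  set τ := Real.sqrt (2 * lam - 1)
  set κ := Real.sqrt (2 * lam + 1)
  have hτ : τ ^ 2 = 2 * lam - 1 := Real.sq_sqrt (by linarith)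
  have hκ : κ ^ 2 = 2 * lam + 1 := Real.sq_sqrt (by linarith)
  have hτ0 : 1 / 2 ≤ τ := Real.le_sqrt_of_sq_le (by linarith)
  have hκ0 : 1 / 2 ≤ κ := Real.le_sqrt_of_sq_le (by linarith)
  have hκ2 : κ < 2 := (Real.sqrt_lt' (by norm_num)).2 (by linarith)
  have hnτ : ‖Complex.I * τ‖ = τ := by
    simp [abs_of_nonneg (show 0 ≤ τ by linarith)]
  have hnκ : ‖(κ : ℂ)‖ = κ := by
    simp [abs_of_nonneg (show 0 ≤ κ by linarith)]
  have hk₁ := abs_greenKernel_le_one (μ := Complex.I * τ) (by simp) (by rwa [hnτ])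
  have hk₂ := abs_greenKernel_le_one (μ := κ) (by simp; linarith) (by rwa [hnκ])
  obtain ⟨h₁, h₂, p, q, hh₁c, hh₂c, hp, hq, hh₁e, hh₂e, hpq₁, hpq₂, hpb, hqb, hh₁, hh₂⟩ :=
    exists_even_solution_coupled_integral_equations (c := fun y => -Real.cos (τ * y))
      hap ham hape hame hapb hamb hε0.le hε
      (continuous_greenKernel (Complex.I * τ)) (continuous_greenKernel κ) hk₁ hk₂
      (greenKernel_neg _) (greenKernel_neg _) (by fun_prop)
      (fun y => by simpa using Real.abs_cos_le_one _) (fun y => by simp)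
  obtain ⟨u', hu'⟩ := exists_hasDerivAt_integral_greenKernel hp hpb (μ := Complex.I * τ)
    (by simp) (norm_pos_iff.1 (by rw [hnτ]; linarith)) (m := -τ ^ 2) (by simp [mul_pow])
  obtain ⟨v', hv'⟩ := exists_hasDerivAt_integral_greenKernel hq hqb (μ := κ)
    (by simpa [abs_of_nonneg (show 0 ≤ κ by linarith)] using hκ2)
    (norm_pos_iff.1 (by rw [hnκ]; linarith)) (m := κ ^ 2) (by simp)
  have hub := abs_integral_kernel_mul_le hk₁ hpb
  have hvb := abs_integral_kernel_mul_le hk₂ hqb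
  set u : ℝ → ℝ := fun y => ∫ s, greenKernel (Complex.I * τ) (y - s) * p s
  set v : ℝ → ℝ := fun y => ∫ s, greenKernel κ (y - s) * q s
  have hcos : ∀ y, HasDerivAt (fun y => -Real.cos (τ * y)) (τ * Real.sin (τ * y)) y := fun y => by
    refine ((hasDerivAt_id y).const_mul τ).cos.neg.congr_deriv ?_
    simp [mul_comm]
  have hsin : ∀ y, HasDerivAt (fun y => τ * Real.sin (τ * y)) (τ ^ 2 * Real.cos (τ * y)) y :=
    fun y => by
      refine (((hasDerivAt_id y).const_mul τ).sin.const_mul τ).congr_deriv ?_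
      simp
      ring
  have hode₁ := contDiff_two_and_deriv_deriv_eq (h := h₁)
    (h'' := fun y => h₁ y + ap y * h₁ y - 2 * lam * h₂ y)
    (fun y => (funext hh₁ : h₁ = _) ▸ (hcos y).add ((hu' y).1.add (hv' y).1))
    (fun y => ((hsin y).add ((hu' y).2.add (hv' y).2)).congr_deriv (by
      linear_combination (Real.cos (τ * y) - u y) * hτ + v y * hκ + hpq₁ y - hh₁ y +
        2 * lam * hh₂ y)) (by fun_prop)
  have hode₂ := contDiff_two_and_deriv_deriv_eq (h := h₂)
    (h'' := fun y => h₂ y + am y * h₂ y - 2 * lam * h₁ y)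
    (fun y => (funext hh₂ : h₂ = _) ▸ (hcos y).add ((hu' y).1.sub (hv' y).1))
    (fun y => ((hsin y).add ((hu' y).2.sub (hv' y).2)).congr_deriv (by
      linear_combination (Real.cos (τ * y) - u y) * hτ - v y * hκ + hpq₂ y - hh₂ y +
        2 * lam * hh₁ y)) (by fun_prop)
  have hb₁ : ∀ y, |h₁ y + Real.cos (τ * y)| ≤ 4 * ε := fun y => by
    have : h₁ y + Real.cos (τ * y) = u y + v y := by rw [hh₁]; ring
    rw [this]
    linarith [abs_add_le (u y) (v y), hub y, hvb y]
  have hb₂ : ∀ y, |h₂ y + Real.cos (τ * y)| ≤ 4 * ε := fun y => by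
    have : h₂ y + Real.cos (τ * y) = u y - v y := by rw [hh₂]; ring
    rw [this]
    linarith [abs_sub (u y) (v y), hub y, hvb y]
  have hbd : ∀ h : ℝ → ℝ, (∀ y, |h y + Real.cos (τ * y)| ≤ 4 * ε) → ∀ y, |h y| ≤ 4 * ε + 1 :=
    fun h hb y => by
      have := abs_sub (h y + Real.cos (τ * y)) (Real.cos (τ * y))
      rw [add_sub_cancel_right] at this
      linarith [hb y, Real.abs_cos_le_one (τ * y)]
  refine ⟨h₁, h₂, ⟨_, hbd h₁ hb₁⟩, ⟨_, hbd h₂ hb₂⟩, hh₁e, hh₂e, hode₁.1, hode₂.1,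
    fun y => ?_, fun y => ?_, hb₁, hb₂⟩
  · rw [hode₁.2]
    ring
  · rw [hode₂.2]
    ring
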